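/- The embedding φ(E) = I_E of the Tamari lattice Tₙ into the permutation lattice Sₙ preserves the height of elements: for every bracketing function E on {1,…,n}, the length of the longest chain from the bottom element to E in Tₙ equals the length of the longest chain from the bottom element to I_E in Sₙ, which equals the cardinality |I_E|. -/

import Mathlib

/-- The inversion set of a permutation `σ` of `Fin n`: pairs `(a, b)` with `a > b`
such that `a` precedes `b` in the word `σ(1) σ(2) ⋯ σ(n)`, i.e. `σ⁻¹ a < σ⁻¹ b`. -/
def InvSet (n : ℕ) (σ : Equiv.Perm (Fin n)) : Set (Fin n × Fin n) :=
  {p | p.2 < p.1 ∧ σ.symm p.1 < σ.symm p.2}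

/-- `A` is the inversion set of some permutation of `Fin n`. -/
def IsInvSet (n : ℕ) (A : Set (Fin n × Fin n)) : Prop :=
  ∃ σ : Equiv.Perm (Fin n), A = InvSet n σ

/-- Condition (I1): `A` is transitive. -/
def CondI1 {n : ℕ} (A : Set (Fin n × Fin n)) : Prop :=
  ∀ a b c : Fin n, (a, b) ∈ A → (b, c) ∈ A → (a, c) ∈ A

/-- Condition (I2): if `b < c < a` and `(a, b) ∈ A`, then `(a, c) ∈ A` or `(c, b) ∈ A`. -/
def CondI2 {n : ℕ} (A : Set (Fin n × Fin n)) : Prop :=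
  ∀ a b c : Fin n, b < c → c < a → (a, b) ∈ A → (a, c) ∈ A ∨ (c, b) ∈ A

/-- Condition (I2)*: if `b < c < a` and `(a, b) ∈ A`, then `(c, b) ∈ A`. -/
def CondI2Star {n : ℕ} (A : Set (Fin n × Fin n)) : Prop :=
  ∀ a b c : Fin n, b < c → c < a → (a, b) ∈ A → (c, b) ∈ A

/-- A bracketing function on `Fin n`: (E1) `k ≤ E k`, and
(E2) if `k ≤ j ≤ E k` then `E j ≤ E k`. -/
def IsBracketing {n : ℕ} (E : Fin n → Fin n) : Prop :=
  (∀ k, k ≤ E k) ∧ ∀ k j, k ≤ j → j ≤ E k → E j ≤ E k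

/-- The set of pairs `I_E = {(a, k) : k < a ≤ E k}` associated to a bracketing function. -/
def IE {n : ℕ} (E : Fin n → Fin n) : Set (Fin n × Fin n) :=
  {p | p.2 < p.1 ∧ p.1 ≤ E p.2}

/-- The transitive closure of a set of pairs. -/
def TrCl {n : ℕ} (A : Set (Fin n × Fin n)) : Set (Fin n × Fin n) :=
  {p | Relation.TransGen (fun a b => (a, b) ∈ A) p.1 p.2}
/-- A chain of length `m` in the Tamari lattice `Tₙ` from the bottom element (the
identity bracketing function) up to `E`: a strictly increasing (in the pointwise order)
sequence of bracketing functions `c 0 = id, …, c m = E`. -/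
def TamariChainTo {n : ℕ} (E : Fin n → Fin n) (m : ℕ) : Prop :=
  ∃ c : Fin (m + 1) → (Fin n → Fin n),
    (∀ i, IsBracketing (c i)) ∧
    (∀ i j : Fin (m + 1), i < j → (∀ k, c i k ≤ c j k) ∧ c i ≠ c j) ∧
    c 0 = id ∧ c (Fin.last m) = E

/-- A chain of length `m` in the permutation lattice `Sₙ` from the bottom element `∅`
up to `A`: a strictly `⊆`-increasing sequence of inversion sets `c 0 = ∅, …, c m = A`. -/
def PermChainTo {n : ℕ} (A : Set (Fin n × Fin n)) (m : ℕ) : Prop :=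
  ∃ c : Fin (m + 1) → Set (Fin n × Fin n),
    (∀ i, IsInvSet n (c i)) ∧
    (∀ i j : Fin (m + 1), i < j → c i ⊂ c j) ∧
    c 0 = ∅ ∧ c (Fin.last m) = A

theorem IE_id (n : ℕ) : IE (id : Fin n → Fin n) = ∅ := by
  ext ⟨a, k⟩
  simp only [IE, id, Set.mem_ofPred_eq, Set.mem_empty_iff_false, iff_false]
  exact fun h => absurd h.1 h.2.not_gt

theorem IE_ssubset {n : ℕ} {E F : Fin n → Fin n} (hE : IsBracketing E) (hF : IsBracketing F)
    (hle : ∀ k, E k ≤ F k) (hne : E ≠ F) : IE E ⊂ IE F := by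
  refine ⟨fun p hp => ⟨hp.1, hp.2.trans (hle _)⟩, fun hsub => hne ?_⟩
  funext k
  refine le_antisymm (hle k) ?_
  rcases (hF.1 k).eq_or_lt with h | h
  · exact h ▸ hE.1 k
  · exact (hsub (show (F k, k) ∈ IE F from ⟨h, le_rfl⟩)).2

/-- A bracketing function other than the identity can be lowered at one point by one step,
which removes exactly one pair from its inversion set. -/
theorem IsBracketing.exists_lower {n : ℕ} {E : Fin n → Fin n} (hE : IsBracketing E)
    (hne : E ≠ id) :
    ∃ F : Fin n → Fin n, IsBracketing F ∧ (∀ k, F k ≤ E k) ∧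
      (IE F).ncard + 1 = (IE E).ncard := by
  obtain ⟨k, hk, hmax⟩ : ∃ k, k < E k ∧ ∀ j, k < j → E j = j := by
    have hS : (Finset.univ.filter fun j => j < E j).Nonempty := by
      obtain ⟨j, hj⟩ := Function.ne_iff.mp hne
      exact ⟨j, by simpa using lt_of_le_of_ne (hE.1 j) (Ne.symm hj)⟩
    refine ⟨_, (Finset.mem_filter.mp (Finset.max'_mem _ hS)).2, fun j hj => ?_⟩
    by_contra hj'
    refine hj.not_ge (Finset.le_max' _ j ?_)
    simpa using lt_of_le_of_ne (hE.1 j) (Ne.symm hj')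
  obtain ⟨e, he⟩ : ∃ e : Fin n, (e : ℕ) + 1 = E k :=
    ⟨⟨(E k : ℕ) - 1, by omega⟩, by simp only; omega⟩
  have hF : ∀ j, Function.update E k e j = if j = k then e else E j :=
    fun j => Function.update_apply E k e j
  have hle : ∀ j, Function.update E k e j ≤ E j := by
    intro j
    rw [hF]
    split_ifs with h
    · subst h; omega
    · exact le_rfl
  refine ⟨Function.update E k e, ⟨fun j => ?_, fun i j hij hji => ?_⟩, hle, ?_⟩
  · rw [hF]
    split_ifs with h
    · subst h; omega
    · exact hE.1 j
  · by_cases hi : i = k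
    · subst hi
      rcases hij.eq_or_lt with rfl | hlt
      · exact le_rfl
      · rw [hF j, if_neg hlt.ne', hmax j hlt]
        exact hji
    · rw [hF i, if_neg hi] at hji ⊢
      exact (hle j).trans (hE.2 i j hij hji)
  · have hins : IE E = insert (E k, k) (IE (Function.update E k e)) := by
      ext ⟨a, b⟩
      simp only [IE, Set.mem_insert_iff, Set.mem_ofPred_eq, Prod.mk.injEq, hF]
      by_cases hb : b = k
      · subst hb
        simp only [if_true, and_true, Fin.ext_iff, Fin.le_def, Fin.lt_def]
        omega
      · simp [hb]
    rw [hins, Set.ncard_insert_of_notMem _ (Set.toFinite _)]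
    simp only [IE, Set.mem_ofPred_eq, hF, if_true]
    omega

theorem TamariChainTo.snoc {n m : ℕ} {E F : Fin n → Fin n} (h : TamariChainTo F m)
    (hE : IsBracketing E) (hle : ∀ k, F k ≤ E k) (hne : F ≠ E) : TamariChainTo E (m + 1) := by
  obtain ⟨c, hb, hc, h0, hl⟩ := h
  refine ⟨Fin.snoc c E, fun i => ?_, fun i j hij => ?_, ?_, by simp⟩
  · induction i using Fin.lastCases with
    | last => simpa using hE
    | cast i => simpa using hb i
  · have hi : i ≠ Fin.last (m + 1) := fun h => by
      subst h; exact hij.not_ge (Fin.le_last j)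
    obtain ⟨i, rfl⟩ := Fin.exists_castSucc_eq.mpr hi
    induction j using Fin.lastCases with
    | cast j => simpa using hc i j (by simpa using hij)
    | last =>
      simp only [Fin.snoc_castSucc, Fin.snoc_last]
      have hiF : ∀ k, c i k ≤ F k := by
        intro k
        rcases (Fin.le_last i).eq_or_lt with h | h
        · rw [h, hl]
        · exact hl ▸ (hc i _ h).1 k
      refine ⟨fun k => (hiF k).trans (hle k), fun h => hne ?_⟩
      funext k
      exact le_antisymm (hle k) (h ▸ hiF k)
  · rw [← Fin.castSucc_zero, Fin.snoc_castSucc, h0]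

theorem IsBracketing.tamariChainTo {n : ℕ} {E : Fin n → Fin n} (hE : IsBracketing E) :
    TamariChainTo E (IE E).ncard := by
  induction hm : (IE E).ncard generalizing E with
  | zero =>
    have hid : E = id := by
      by_contra hne
      obtain ⟨F, -, -, h⟩ := hE.exists_lower hne
      omega
    refine ⟨fun _ => E, fun _ => hE, fun i j hij => ?_, hid, rfl⟩
    omega
  | succ m ih =>
    have hne : E ≠ id := by
      rintro rfl
      simp [IE_id] at hm
    obtain ⟨F, hF, hle, h⟩ := hE.exists_lower hne
    refine (ih hF (by omega)).snoc hE hle ?_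
    rintro rfl
    omega

/-- For a bracketing function `E`, the set `IE E` is the inversion set of the permutation
listing `Fin n` so that `a` precedes `b` iff `b < a ≤ E b` or `E a < b`. -/
theorem IsBracketing.isInvSet_IE {n : ℕ} {E : Fin n → Fin n} (hE : IsBracketing E) :
    IsInvSet n (IE E) := by
  classical
  let R : Fin n → Fin n → Prop := fun a b => (b < a ∧ a ≤ E b) ∨ E a < b
  have hirr : ∀ a, ¬ R a a := fun a h => by
    have := hE.1 a
    rcases h with h | h <;> omega
  have htr : ∀ a b c, R a b → R b c → R a c := by
    intro a b c hab hbc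
    have := hE.1 a
    have := hE.1 b
    have := hE.1 c
    have := hE.2 a c
    have := hE.2 b a
    have := hE.2 c b
    simp only [R] at hab hbc ⊢
    omega
  have htri : ∀ a b, a ≠ b → R a b ∨ R b a := by
    intro a b hab
    simp only [R]
    omega
  let S : Fin n → Finset (Fin n) := fun a => Finset.univ.filter fun b => R b a
  have hS : ∀ a, (S a).card < n := fun a => by
    have h : S a ⊂ Finset.univ :=
      (Finset.ssubset_univ_iff).mpr fun h => hirr a (by
        have := h ▸ Finset.mem_univ a
        simpa [S] using this)
    simpa using Finset.card_lt_card h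
  have hlt : ∀ a b, R a b → (S a).card < (S b).card := fun a b hab => by
    refine Finset.card_lt_card ⟨fun x hx => ?_, fun h => hirr a ?_⟩
    · simp only [S, Finset.mem_filter, Finset.mem_univ, true_and] at hx ⊢
      exact htr x a b hx hab
    · have := h (show a ∈ S b by simpa [S] using hab)
      simpa [S] using this
  let r : Fin n → Fin n := fun a => ⟨(S a).card, hS a⟩
  have hinj : Function.Injective r := fun a b hab => by
    by_contra hne
    have hab' : (S a).card = (S b).card := congrArg Fin.val hab
    rcases htri a b hne with h | h
    · exact (hlt a b h).ne hab'
    · exact (hlt b a h).ne' hab'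
  have hiff : ∀ a b, r a < r b ↔ R a b := fun a b => by
    refine ⟨fun h => ?_, hlt a b⟩
    have hne : a ≠ b := fun hab => h.ne (hab ▸ rfl)
    exact (htri a b hne).resolve_right fun h' => lt_asymm h (hlt b a h')
  refine ⟨(Equiv.ofBijective r (Finite.injective_iff_bijective.mp hinj)).symm, ?_⟩
  ext ⟨a, b⟩
  simp only [IE, InvSet, Set.mem_ofPred_eq, Equiv.symm_symm, Equiv.ofBijective_apply, hiff, R]
  have := hE.1 a
  omega

theorem le_ncard_of_ssubset_chain {α : Type*} [Finite α] {m : ℕ} (c : Fin (m + 1) → Set α)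
    (hc : ∀ i j, i < j → c i ⊂ c j) (i : Fin (m + 1)) : (i : ℕ) ≤ (c i).ncard := by
  induction i using Fin.induction with
  | zero => exact Nat.zero_le _
  | succ i ih =>
    have := Set.ncard_lt_ncard (hc _ _ (Fin.castSucc_lt_succ (i := i))) (Set.toFinite _)
    rw [Fin.val_castSucc] at ih
    rw [Fin.val_succ]
    omega

theorem PermChainTo.le_ncard {n m : ℕ} {A : Set (Fin n × Fin n)} (h : PermChainTo A m) :
    m ≤ A.ncard := by
  obtain ⟨c, -, hc, -, rfl⟩ := h
  simpa using le_ncard_of_ssubset_chain c hc (Fin.last m)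

theorem TamariChainTo.permChainTo {n m : ℕ} {E : Fin n → Fin n} (h : TamariChainTo E m) :
    PermChainTo (IE E) m := by
  obtain ⟨c, hb, hc, h0, rfl⟩ := h
  exact ⟨fun i => IE (c i), fun i => (hb i).isInvSet_IE,
    fun i j hij => IE_ssubset (hb i) (hb j) (hc i j hij).1 (hc i j hij).2,
    (congrArg IE h0).trans (IE_id n), rfl⟩

/-- The embedding `E ↦ I_E` preserves heights: for every bracketing function `E`, the
length of the longest chain from the bottom to `E` in `Tₙ` equals the length of the
longest chain from the bottom to `I_E` in `Sₙ`, and both equal the cardinality `|I_E|`. -/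
theorem stmt_16 (n : ℕ) (E : Fin n → Fin n) (hE : IsBracketing E) :
    TamariChainTo E (IE E).ncard ∧
    (∀ m : ℕ, TamariChainTo E m → m ≤ (IE E).ncard) ∧
    PermChainTo (IE E) (IE E).ncard ∧
    (∀ m : ℕ, PermChainTo (IE E) m → m ≤ (IE E).ncard) :=
  ⟨hE.tamariChainTo, fun _ h => h.permChainTo.le_ncard, hE.tamariChainTo.permChainTo,
    fun _ h => h.le_ncard⟩
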